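/- arXiv:2001.03788 — 4 statements merged into one kernel-verified Lean document; each statement's English description precedes it below -/
import Mathlib

section
/- Let G=(V,E) be a twinless strongly connected directed graph, and let G¹=(V,E¹) with E¹ ⊆ E be a strongly connected spanning subgraph of G that is not twinless strongly connected. Let (v,w) ∈ E∖E¹ be an edge such that v and w lie in distinct twinless strongly connected components of G¹. If G¹ has exactly k twinless strongly connected components, then the directed graph (V, E¹ ∪ {(v,w)}) has strictly fewer than k twinless strongly connected components. -/
/-- `F` contains no pair of antiparallel edges. -/
def NoAntiparallel {V : Type*} (F : Finset (V × V)) : Prop :=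
  ∀ a b : V, (a, b) ∈ F → (b, a) ∉ F

/-- There is a directed path from `u` to `v` using edges of `F` that stay inside `S`. -/
def PathOn {V : Type*} (F : Finset (V × V)) (S : Set V) (u v : V) : Prop :=
  Relation.ReflTransGen (fun a b => a ∈ S ∧ b ∈ S ∧ (a, b) ∈ F) u v

/-- The subgraph of `(V, E)` induced on `S` is strongly connected. -/
def StronglyConnectedOn {V : Type*} (E : Finset (V × V)) (S : Set V) : Prop :=
  ∀ u ∈ S, ∀ v ∈ S, PathOn E S u v

/-- The subgraph of `(V, E)` induced on `S` is twinless strongly connected. -/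
def TwinlessSConnOn {V : Type*} (E : Finset (V × V)) (S : Set V) : Prop :=
  ∃ E' ⊆ E, NoAntiparallel E' ∧ StronglyConnectedOn E' S

/-- `(V, E)` is 2-vertex-connected. -/
def TwoVertexConnected (V : Type*) [Fintype V] (E : Finset (V × V)) : Prop :=
  3 ≤ Fintype.card V ∧ ∀ U : Finset V, U.card ≤ 1 → StronglyConnectedOn E (↑U)ᶜ

/-- `(V, E)` is 2-vertex-twinless connected. -/
def TwoVertexTwinlessConnected (V : Type*) [Fintype V] (E : Finset (V × V)) : Prop :=
  3 ≤ Fintype.card V ∧ ∀ U : Finset V, U.card ≤ 1 → TwinlessSConnOn E (↑U)ᶜ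

/-- `u` and `v` are twinless strongly connected in the subgraph of `(V, E)` induced on `S`. -/
def TwinlessRelOn {V : Type*} (E : Finset (V × V)) (S : Set V) (u v : V) : Prop :=
  ∃ F ⊆ E, NoAntiparallel F ∧ PathOn F S u v ∧ PathOn F S v u

/-- `u` and `v` are twinless strongly connected in `(V, E)`. -/
def TwinlessRel {V : Type*} (E : Finset (V × V)) (u v : V) : Prop :=
  TwinlessRelOn E Set.univ u v

/-- `C` is a twinless strongly connected component of `(V, E)`. -/
def IsTSCC {V : Type*} (E : Finset (V × V)) (C : Set V) : Prop :=
  ∃ v : V, C = {u | TwinlessRel E v u}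

/-- The number of twinless strongly connected components of `(V, E)`. -/
noncomputable def numTSCC (V : Type*) (E : Finset (V × V)) : ℕ :=
  Set.ncard {C : Set V | IsTSCC E C}

theorem PathOn.mono {V : Type*} {F F' : Finset (V × V)} {S : Set V} {u v : V} (h : F ⊆ F')
    (p : PathOn F S u v) : PathOn F' S u v :=
  Relation.ReflTransGen.mono (fun _ _ e => ⟨e.1, e.2.1, h e.2.2⟩) _ _ p

theorem PathOn.single {V : Type*} {F : Finset (V × V)} {u v : V} (h : (u, v) ∈ F) :
    PathOn F Set.univ u v :=
  Relation.ReflTransGen.single ⟨trivial, trivial, h⟩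

theorem TwinlessRel.refl {V : Type*} (E : Finset (V × V)) (u : V) : TwinlessRel E u u :=
  ⟨∅, by simp, by intro a b h; simp at h, Relation.ReflTransGen.refl, Relation.ReflTransGen.refl⟩

theorem TwinlessRel.symm {V : Type*} {E : Finset (V × V)} {u v : V} (h : TwinlessRel E u v) :
    TwinlessRel E v u := by
  obtain ⟨F, hF, hn, p, q⟩ := h
  exact ⟨F, hF, hn, q, p⟩

theorem TwinlessRel.mono {V : Type*} {E E' : Finset (V × V)} {u v : V} (hE : E ⊆ E')
    (h : TwinlessRel E u v) : TwinlessRel E' u v := by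
  obtain ⟨F, hF, hn, p, q⟩ := h
  exact ⟨F, hF.trans hE, hn, p, q⟩

open Classical in
/-- A path between two vertices of a strong component stays inside the component. -/
theorem PathOn.filter_strongComponent {V : Type*} {F : Finset (V × V)} {u a b : V}
    (hua : PathOn F Set.univ u a) (hab : PathOn F Set.univ a b) (hbu : PathOn F Set.univ b u) :
    PathOn (F.filter fun e =>
      (PathOn F Set.univ u e.1 ∧ PathOn F Set.univ e.1 u) ∧
        (PathOn F Set.univ u e.2 ∧ PathOn F Set.univ e.2 u)) Set.univ a b := by
  induction hab with
  | refl => exact Relation.ReflTransGen.refl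
  | @tail x y hax hxy ih =>
    have hxu : PathOn F Set.univ x u := Relation.ReflTransGen.head hxy hbu
    have hux : PathOn F Set.univ u x := Relation.ReflTransGen.trans hua hax
    refine Relation.ReflTransGen.tail (ih hxu) ⟨trivial, trivial, ?_⟩
    exact Finset.mem_filter.2 ⟨hxy.2.2, ⟨hux, hxu⟩, Relation.ReflTransGen.tail hux hxy, hbu⟩

theorem TwinlessRel.trans {V : Type*} {E : Finset (V × V)} {u v w : V}
    (huv : TwinlessRel E u v) (hvw : TwinlessRel E v w) : TwinlessRel E u w := by
  classical
  obtain ⟨F₁, hF₁, hn₁, p₁, q₁⟩ := huv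
  obtain ⟨F₂, hF₂, hn₂, p₂, q₂⟩ := hvw
  set S : Set V := {x | PathOn F₁ Set.univ u x ∧ PathOn F₁ Set.univ x u} with hS
  set A := F₁.filter fun e => e.1 ∈ S ∧ e.2 ∈ S with hA
  set B := F₂.filter fun e => ¬ (e.1 ∈ S ∧ e.2 ∈ S) with hB
  have to_S : ∀ x ∈ S, PathOn (A ∪ B) Set.univ u x := fun x hx =>
    (PathOn.filter_strongComponent Relation.ReflTransGen.refl hx.1 hx.2).mono
      Finset.subset_union_left
  have from_S : ∀ x ∈ S, PathOn (A ∪ B) Set.univ x u := fun x hx =>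
    (PathOn.filter_strongComponent hx.1 hx.2 Relation.ReflTransGen.refl).mono
      Finset.subset_union_left
  have edge : ∀ x y, (x, y) ∈ F₂ → ¬ (x ∈ S ∧ y ∈ S) → PathOn (A ∪ B) Set.univ x y :=
    fun x y hxy hn => PathOn.single
      (Finset.mem_union_right _ (Finset.mem_filter.2 ⟨hxy, hn⟩))
  refine ⟨A ∪ B, ?_, ?_, ?_, ?_⟩
  · exact Finset.union_subset ((Finset.filter_subset _ _).trans hF₁)
      ((Finset.filter_subset _ _).trans hF₂)
  · intro a b h h'
    have := hn₁ a b
    have := hn₂ a b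
    simp only [hA, hB, Finset.mem_union, Finset.mem_filter] at h h'
    tauto
  · clear q₂
    induction p₂ with
    | refl => exact to_S v ⟨p₁, q₁⟩
    | @tail x y _ hxy ih =>
      by_cases h : x ∈ S ∧ y ∈ S
      · exact to_S y h.2
      · exact Relation.ReflTransGen.trans ih (edge x y hxy.2.2 h)
  · clear p₂
    induction q₂ using Relation.ReflTransGen.head_induction_on with
    | refl => exact from_S v ⟨p₁, q₁⟩
    | @head x y hxy _ ih =>
      by_cases h : x ∈ S ∧ y ∈ S
      · exact from_S x h.1
      · exact Relation.ReflTransGen.trans (edge x y hxy.2.2 h) ih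

/-- Every path contains one that uses no pair of antiparallel edges. -/
theorem PathOn.exists_noAntiparallel {V : Type*} {E : Finset (V × V)} {u v : V}
    (p : PathOn E Set.univ u v) :
    ∃ F ⊆ E, NoAntiparallel F ∧ PathOn F Set.univ u v := by
  classical
  suffices h : ∃ F ⊆ E, NoAntiparallel F ∧ PathOn F Set.univ u v ∧
      ∀ x y, (x, y) ∈ F → PathOn F Set.univ u x by
    obtain ⟨F, hF, hn, q, -⟩ := h
    exact ⟨F, hF, hn, q⟩
  induction p with
  | refl => exact ⟨∅, by simp, by intro a b h; simp at h, Relation.ReflTransGen.refl, by simp⟩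
  | @tail b c _ hbc ih =>
    obtain ⟨F, hF, hn, q, hr⟩ := ih
    by_cases hc : PathOn F Set.univ u c
    · exact ⟨F, hF, hn, hc, hr⟩
    have hcb : c ≠ b := by rintro rfl; exact hc q
    have hsub : F ⊆ insert (b, c) F := Finset.subset_insert _ _
    refine ⟨insert (b, c) F, Finset.insert_subset hbc.2.2 hF, ?_, ?_, ?_⟩
    · have hout : ∀ y, (c, y) ∉ F := fun y h => hc (hr c y h)
      intro x y h h'
      simp only [Finset.mem_insert, Prod.mk.injEq] at h h'
      rcases h with ⟨rfl, rfl⟩ | h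
      · rcases h' with ⟨h1, -⟩ | h'
        · exact hcb h1
        · exact hout _ h'
      · rcases h' with ⟨rfl, rfl⟩ | h'
        · exact hout _ h
        · exact hn x y h h'
    · exact Relation.ReflTransGen.trans (q.mono hsub) (PathOn.single (Finset.mem_insert_self _ _))
    · intro x y h
      rcases Finset.mem_insert.1 h with h | h
      · obtain ⟨rfl, rfl⟩ := Prod.mk.inj h
        exact q.mono hsub
      · exact (hr x y h).mono hsub

/-- A path from `a` to `b` closed up by the edge `(b, a)` makes `a` and `b` twinless strongly
connected, unless `(a, b)` is itself an available edge. -/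
theorem TwinlessRel.of_path_of_edge {V : Type*} [DecidableEq V] {E : Finset (V × V)} {a b : V}
    (hne : a ≠ b) (hab : (a, b) ∉ E) (p : PathOn E Set.univ a b) :
    TwinlessRel (insert (b, a) E) a b := by
  obtain ⟨F, hF, hn, q⟩ := p.exists_noAntiparallel
  refine ⟨insert (b, a) F, Finset.insert_subset_insert _ hF, ?_,
    q.mono (Finset.subset_insert _ _), PathOn.single (Finset.mem_insert_self _ _)⟩
  have hF' : (a, b) ∉ F := fun h => hab (hF h)
  intro x y h h'
  simp only [Finset.mem_insert, Prod.mk.injEq] at h h'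
  rcases h with ⟨rfl, rfl⟩ | h
  · rcases h' with ⟨h1, -⟩ | h'
    · exact hne h1
    · exact hF' h'
  · rcases h' with ⟨rfl, rfl⟩ | h'
    · exact hF' h
    · exact hn x y h h'

theorem TwinlessRel.setOf_eq {V : Type*} {E : Finset (V × V)} {u v : V} (h : TwinlessRel E u v) :
    {x | TwinlessRel E u x} = {x | TwinlessRel E v x} :=
  Set.ext fun _ => ⟨fun hx => h.symm.trans hx, fun hx => h.trans hx⟩

/-- Adding edges that merge two components decreases the number of components. -/
theorem numTSCC_lt_of_merge {V : Type*} [Finite V] {E E' : Finset (V × V)} (hE : E ⊆ E') {v w : V}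
    (h : ¬ TwinlessRel E v w) (h' : TwinlessRel E' v w) : numTSCC V E' < numTSCC V E := by
  let g : Set V → Set V := fun C => {x | ∃ y ∈ C, TwinlessRel E' y x}
  have hg : ∀ u, g {x | TwinlessRel E u x} = {x | TwinlessRel E' u x} := fun u => Set.ext fun x =>
    ⟨fun ⟨_, hy, hyx⟩ => (TwinlessRel.mono hE hy).trans hyx, fun hx => ⟨u, .refl E u, hx⟩⟩
  have himage : {C | IsTSCC E' C} = g '' {C | IsTSCC E C} := by
    ext C
    constructor
    · rintro ⟨u, rfl⟩
      exact ⟨_, ⟨u, rfl⟩, hg u⟩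
    · rintro ⟨_, ⟨u, rfl⟩, rfl⟩
      exact ⟨u, hg u⟩
  unfold numTSCC
  rw [himage]
  refine lt_of_le_of_ne (Set.ncard_image_le (Set.toFinite _)) fun heq => h ?_
  have hinj := Set.injOn_of_ncard_image_eq heq (Set.toFinite _)
  have hvw : {x | TwinlessRel E v x} = {x | TwinlessRel E w x} :=
    hinj ⟨v, rfl⟩ ⟨w, rfl⟩ (by rw [hg, hg, h'.setOf_eq])
  exact hvw.symm.subset (TwinlessRel.refl E w)

/-- adding an edge between distinct twinless strongly connected components
of a strongly connected spanning subgraph strictly decreases the number of TSCCs. -/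
theorem stmt3 {V : Type*} [Fintype V] [DecidableEq V]
    (E E1 : Finset (V × V)) (v w : V) (k : ℕ)
    (hG : TwinlessSConnOn E (Set.univ : Set V))
    (hsub : E1 ⊆ E) (hsc : StronglyConnectedOn E1 (Set.univ : Set V))
    (hnt : ¬ TwinlessSConnOn E1 (Set.univ : Set V))
    (hedge : (v, w) ∈ E \ E1)
    (hdist : ¬ TwinlessRel E1 v w)
    (hk : numTSCC V E1 = k) :
    numTSCC V (insert (v, w) E1) < k := by
  obtain ⟨-, hvw⟩ := Finset.mem_sdiff.1 hedge
  have hne : v ≠ w := by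
    rintro rfl
    exact hdist (TwinlessRel.refl E1 v)
  have hwv : (w, v) ∉ E1 := fun h => hdist <| by
    simpa [Finset.insert_eq_of_mem h] using
      TwinlessRel.of_path_of_edge hne hvw (hsc v trivial w trivial)
  rw [← hk]
  exact numTSCC_lt_of_merge (Finset.subset_insert _ _) hdist
    (TwinlessRel.of_path_of_edge hne.symm hwv (hsc w trivial v trivial)).symm
end

section
/- Let G¹=(V,E¹) be a directed graph, let C₁ and C₂ be two distinct twinless strongly connected components of G¹, and let v ∈ C₁ and w ∈ C₂. Let e ∈ V×V be an edge such that v and w are twinless strongly connected in the directed graph (V, E¹ ∪ {e}). Then all vertices of C₁ ∪ C₂ lie in one single twinless strongly connected component of (V, E¹ ∪ {e}). -/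
open Relation in
/-- A path from `a` to `b`, where `a` is reachable from `v` and `v` from `b`, stays inside the strong
component of `v`. -/
theorem Relation.ReflTransGen.restrict_strongComponent {α : Type*} {r : α → α → Prop} {v a b : α}
    (hab : ReflTransGen r a b) (hva : ReflTransGen r v a) (hbv : ReflTransGen r b v) :
    ReflTransGen (fun x y => r x y ∧ (ReflTransGen r v x ∧ ReflTransGen r x v) ∧
      (ReflTransGen r v y ∧ ReflTransGen r y v)) a b := by
  induction hab using ReflTransGen.head_induction_on with
  | refl => exact .refl
  | head hac hcb ih =>
    have hvc := hva.tail hac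
    have hcv := hcb.trans hbv
    exact (ih hvc).head ⟨hac, ⟨hva, hcv.head hac⟩, hvc, hcv⟩

/-- if `v ∈ C₁` and `w ∈ C₂` for distinct TSCCs `C₁, C₂` of `(V, E¹)` and
`v, w` become twinless strongly connected after adding an edge `e`, then all of `C₁ ∪ C₂`
lies in a single TSCC of `(V, E¹ ∪ {e})`. -/
theorem stmt6 {V : Type*} [Fintype V] [DecidableEq V]
    (E1 : Finset (V × V)) (C1 C2 : Set V) (v w : V) (e : V × V)
    (hC1 : IsTSCC E1 C1) (hC2 : IsTSCC E1 C2) (hne : C1 ≠ C2)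
    (hv : v ∈ C1) (hw : w ∈ C2)
    (hrel : TwinlessRel (insert e E1) v w) :
    ∃ C : Set V, IsTSCC (insert e E1) C ∧ C1 ∪ C2 ⊆ C := by
  obtain ⟨c, rfl⟩ := hC1
  obtain ⟨d, rfl⟩ := hC2
  have hE : E1 ⊆ insert e E1 := Finset.subset_insert e E1
  refine ⟨_, ⟨v, rfl⟩, Set.union_subset ?_ ?_⟩
  · exact fun x hx => (hv.symm.trans hx).mono hE
  · exact fun x hx => hrel.trans ((hw.symm.trans hx).mono hE)
end

section
/- Let G=(V,E) be a 2-vertex-twinless connected directed graph, let x ∈ V, and let E_t ⊆ E be such that the subgraph of (V,E_t) induced on V∖{x} is strongly connected but not twinless strongly connected. Then there exists an edge (v,w) ∈ E∖E_t with v ≠ x and w ≠ x such that v and w lie in distinct twinless strongly connected components of the subgraph of (V,E_t) induced on V∖{x}. -/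
/-- A path from inside `A` to outside `A` uses an edge leaving `A`. -/
theorem PathOn.exists_leaving {V : Type*} {F : Finset (V × V)} {S A : Set V} {u v : V}
    (h : PathOn F S u v) (hu : u ∈ A) (hv : v ∉ A) :
    ∃ p ∈ S, ∃ q ∈ S, (p, q) ∈ F ∧ p ∈ A ∧ q ∉ A := by
  induction h with
  | refl => exact absurd hu hv
  | @tail b c _ hbc ih =>
    by_cases hb : b ∈ A
    · exact ⟨b, hbc.1, c, hbc.2.1, hbc.2.2, hb, hv⟩
    · exact ih hb

/-- An edge whose endpoints stay connected without it can be deleted. -/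
theorem StronglyConnectedOn.erase {V : Type*} [DecidableEq V] {F : Finset (V × V)} {S : Set V}
    (h : StronglyConnectedOn F S) {a b : V}
    (hab : a ∈ S → b ∈ S → PathOn (F.erase (a, b)) S a b) :
    StronglyConnectedOn (F.erase (a, b)) S := by
  intro u hu v hv
  have huv := h u hu v hv
  induction huv with
  | refl => exact Relation.ReflTransGen.refl
  | @tail c d _ hcd ih =>
    refine (ih hcd.1).trans ?_
    by_cases he : (c, d) = (a, b)
    · obtain ⟨rfl, rfl⟩ := Prod.mk.inj he
      exact hab hcd.1 hcd.2.1
    · exact Relation.ReflTransGen.single ⟨hcd.1, hcd.2.1, Finset.mem_erase.2 ⟨he, hcd.2.2⟩⟩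

/-- If deleting `(a, b)` destroys strong connectivity, then `(a, b)` is the only edge leaving
some set that contains `a` but not `b`. -/
theorem StronglyConnectedOn.exists_unique_leaving {V : Type*} [DecidableEq V]
    {F : Finset (V × V)} {S : Set V} (h : StronglyConnectedOn F S) {a b : V}
    (hab : ¬ StronglyConnectedOn (F.erase (a, b)) S) :
    a ∈ S ∧ b ∈ S ∧ ∃ A : Set V, a ∈ A ∧ b ∉ A ∧
      ∀ u ∈ S, ∀ v ∈ S, (u, v) ∈ F → u ∈ A → v ∉ A → u = a ∧ v = b := by
  have hn := mt h.erase hab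
  push Not at hn
  obtain ⟨ha, hb, hp⟩ := hn
  refine ⟨ha, hb, {v | PathOn (F.erase (a, b)) S a v}, Relation.ReflTransGen.refl, hp, ?_⟩
  intro u hu v hv huv hAu hAv
  by_contra hne
  exact hAv (Relation.ReflTransGen.tail hAu
    ⟨hu, hv, Finset.mem_erase.2 ⟨fun he => hne (Prod.mk.inj he), huv⟩⟩)

/-- A strongly connected graph in which no cut consists of a single pair of antiparallel edges
is twinless strongly connected (Raghavan); stated contrapositively. -/
theorem StronglyConnectedOn.exists_bridge {V : Type*} [DecidableEq V] {E : Finset (V × V)}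
    {S : Set V} (h : StronglyConnectedOn E S) (hnt : ¬ TwinlessSConnOn E S) :
    ∃ a ∈ S, ∃ b ∈ S, ∃ A : Set V, a ∈ A ∧ b ∉ A ∧
      ∀ u ∈ S, ∀ v ∈ S, u ∈ A → v ∉ A → (u, v) ∈ E ∨ (v, u) ∈ E → u = a ∧ v = b := by
  classical
  -- a minimal strongly connected subgraph with the same underlying simple graph
  let P : Finset (V × V) → Prop := fun F => F ⊆ E ∧ StronglyConnectedOn F S ∧
    ∀ u v, u ≠ v → (u, v) ∈ E → (u, v) ∈ F ∨ (v, u) ∈ F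
  obtain ⟨F, ⟨hFE, hF, hcov⟩, hmin⟩ := WellFounded.has_min
    (wellFounded_lt (α := Finset (V × V))) {F | P F} ⟨E, subset_rfl, h, fun _ _ _ he => Or.inl he⟩
  have key : ∀ a b, (a, b) ∈ F → (b, a) ∈ F → ¬ StronglyConnectedOn (F.erase (a, b)) S := by
    intro a b hab hba hs
    refine hmin (F.erase (a, b)) ⟨(Finset.erase_subset _ _).trans hFE, hs, ?_⟩
      (Finset.erase_ssubset hab)
    intro u v huv he
    have := hcov u v huv he
    simp only [Finset.mem_erase, ne_eq, Prod.mk.injEq]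
    grind
  have hanti : ¬ NoAntiparallel F := fun hF' => hnt ⟨F, hFE, hF', hF⟩
  simp only [NoAntiparallel] at hanti
  push Not at hanti
  obtain ⟨a, b, hab, hba⟩ := hanti
  obtain ⟨ha, hb, A, haA, hbA, hA⟩ := hF.exists_unique_leaving (key a b hab hba)
  obtain ⟨-, -, B, hbB, haB, hB⟩ := hF.exists_unique_leaving (key b a hba hab)
  have hdisj : ∀ u ∈ S, u ∈ A → u ∉ B := by
    intro u hu huA huB
    obtain ⟨p, hp, q, hq, hpq, hpAB, hqAB⟩ :=
      (hF u hu a ha).exists_leaving (A := A ∩ B) ⟨huA, huB⟩ fun h => haB h.2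
    by_cases hqA : q ∈ A
    · obtain ⟨rfl, rfl⟩ := hB p hp q hq hpq hpAB.2 fun h => hqAB ⟨hqA, h⟩
      exact hbA hpAB.1
    · obtain ⟨rfl, rfl⟩ := hA p hp q hq hpq hpAB.1 hqA
      exact haB hpAB.2
  have hcover : ∀ u ∈ S, u ∉ A → u ∈ B := by
    intro u hu huA
    by_contra huB
    obtain ⟨p, hp, q, hq, hpq, hpAB, hqAB⟩ :=
      (hF a ha u hu).exists_leaving (A := A ∪ B) (Or.inl haA) fun h => h.elim huA huB
    rcases hpAB with hpA | hpB
    · obtain ⟨rfl, rfl⟩ := hA p hp q hq hpq hpA fun h => hqAB (Or.inl h)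
      exact hqAB (Or.inr hbB)
    · obtain ⟨rfl, rfl⟩ := hB p hp q hq hpq hpB fun h => hqAB (Or.inr h)
      exact hqAB (Or.inl haA)
  refine ⟨a, ha, b, hb, A, haA, hbA, fun u hu v hv huA hvA he => ?_⟩
  have hne : u ≠ v := fun h => hvA (h ▸ huA)
  have hF' : (u, v) ∈ F ∨ (v, u) ∈ F :=
    he.elim (hcov u v hne) fun h => (hcov v u hne.symm h).symm
  rcases hF' with h' | h'
  · exact hA u hu v hv h' huA hvA
  · exact (hB v hv u hu h' (hcover v hv hvA) (hdisj u hu huA)).symm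

/-- Connecting both sides of a cut in both directions without antiparallel edges uses an edge
of the cut other than those on a given pair of vertices. -/
theorem NoAntiparallel.exists_crossing {V : Type*} {F : Finset (V × V)} {S A : Set V}
    (hF : NoAntiparallel F) {u v : V} (huv : PathOn F S u v) (hvu : PathOn F S v u)
    (hu : u ∈ A) (hv : v ∉ A) (a b : V) :
    ∃ p ∈ S, ∃ q ∈ S, p ∈ A ∧ q ∉ A ∧ ((p, q) ∈ F ∨ (q, p) ∈ F) ∧ ¬ (p = a ∧ q = b) := by
  obtain ⟨p, hp, q, hq, hpq, hpA, hqA⟩ := huv.exists_leaving hu hv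
  obtain ⟨r, hr, s, hs, hrs, hrA, hsA⟩ :=
    hvu.exists_leaving (A := Aᶜ) hv fun h => h hu
  by_cases h : p = a ∧ q = b
  · refine ⟨s, hs, r, hr, not_not.1 hsA, hrA, Or.inr hrs, fun h' => hF p q hpq ?_⟩
    rwa [h.1, h.2, ← h'.1, ← h'.2]
  · exact ⟨p, hp, q, hq, hpA, hqA, Or.inl hpq, h⟩

/-- in a 2-vertex-twinless connected graph `G = (V, E)`, if the subgraph of
`(V, Eₜ)` induced on `V ∖ {x}` is strongly connected but not twinless strongly connected,
then some edge of `E ∖ Eₜ` avoiding `x` joins two distinct TSCCs of that induced subgraph. -/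
theorem stmt7 {V : Type*} [Fintype V] [DecidableEq V] (E Et : Finset (V × V)) (x : V)
    (hG : TwoVertexTwinlessConnected V E) (hsub : Et ⊆ E)
    (hsc : StronglyConnectedOn Et ({x}ᶜ : Set V))
    (hnt : ¬ TwinlessSConnOn Et ({x}ᶜ : Set V)) :
    ∃ v w : V, (v, w) ∈ E \ Et ∧ v ≠ x ∧ w ≠ x ∧
      ¬ TwinlessRelOn Et ({x}ᶜ : Set V) v w := by
  obtain ⟨a, ha, b, hb, A, haA, hbA, hcut⟩ := hsc.exists_bridge hnt
  obtain ⟨E', hE', hanti, hconn⟩ : TwinlessSConnOn E ({x}ᶜ : Set V) := by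
    simpa using hG.2 {x} (by simp)
  obtain ⟨p, hp, q, hq, hpA, hqA, hpq, hne⟩ :=
    hanti.exists_crossing (hconn a ha b hb) (hconn b hb a ha) haA hbA a b
  have hsep : ∀ F ⊆ Et, NoAntiparallel F → PathOn F {x}ᶜ p q → PathOn F {x}ᶜ q p → False := by
    intro F hF hFa h₁ h₂
    obtain ⟨u, hu, v, hv, huA, hvA, huv, hne'⟩ := hFa.exists_crossing h₁ h₂ hpA hqA a b
    exact hne' (hcut u hu v hv huA hvA (huv.imp (@hF _) (@hF _)))
  have hnot := mt (hcut p hp q hq hpA hqA) hne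
  rcases hpq with h | h
  · exact ⟨p, q, Finset.mem_sdiff.2 ⟨hE' h, fun h' => hnot (Or.inl h')⟩, hp, hq,
      fun ⟨F, hF, hFa, h₁, h₂⟩ => hsep F hF hFa h₁ h₂⟩
  · exact ⟨q, p, Finset.mem_sdiff.2 ⟨hE' h, fun h' => hnot (Or.inr h')⟩, hq, hp,
      fun ⟨F, hF, hFa, h₁, h₂⟩ => hsep F hF hFa h₂ h₁⟩
end

section
/- Let G=(V,E) be a 2-vertex-twinless connected directed graph with n = |V| vertices (and no self-loops). Then every E_{2t} ⊆ E such that (V,E_{2t}) is 2-vertex-twinless connected satisfies |E_{2t}| ≥ 2n. -/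
theorem PathOn.exists_first_edge {V : Type*} {F : Finset (V × V)} {S : Set V} {u v : V}
    (h : PathOn F S u v) (huv : u ≠ v) : ∃ w ∈ S, (u, w) ∈ F := by
  rcases Relation.ReflTransGen.cases_head h with rfl | ⟨w, ⟨_, hw, huw⟩, _⟩
  · exact absurd rfl huv
  · exact ⟨w, hw, huw⟩

theorem TwoVertexTwinlessConnected.twoVertexConnected {V : Type*} [Fintype V]
    {E : Finset (V × V)} (h : TwoVertexTwinlessConnected V E) : TwoVertexConnected V E := by
  refine ⟨h.1, fun U hU u hu v hv => ?_⟩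
  obtain ⟨E', hE', _, hconn⟩ := h.2 U hU
  exact Relation.ReflTransGen.mono (fun _ _ hab => ⟨hab.1, hab.2.1, hE' hab.2.2⟩)
    u v (hconn u hu v hv)

/-- Every vertex of a loopless 2-vertex-connected graph has two distinct out-neighbours. -/
theorem TwoVertexConnected.exists_two_outNeighbors {V : Type*} [Fintype V]
    {E : Finset (V × V)} (h : TwoVertexConnected V E) (hloop : ∀ u : V, (u, u) ∉ E) (v : V) :
    ∃ w₁ w₂, w₁ ≠ w₂ ∧ (v, w₁) ∈ E ∧ (v, w₂) ∈ E := by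
  classical
  have avoid : ∀ w : V, ∃ x, x ≠ v ∧ x ≠ w := fun w => by
    obtain ⟨x, hx⟩ := Finset.exists_mem_notMem_of_card_lt_card
      (s := {v, w}) (t := Finset.univ)
      (lt_of_le_of_lt Finset.card_le_two (by rw [Finset.card_univ]; exact h.1))
    exact ⟨x, by simpa using hx.2⟩
  obtain ⟨x, hxv, _⟩ := avoid v
  obtain ⟨w₁, _, hw₁⟩ := (h.2 ∅ (by simp) v (by simp) x (by simp)).exists_first_edge hxv.symm
  have hvw : v ≠ w₁ := by
    rintro rfl
    exact hloop _ hw₁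
  obtain ⟨y, hyv, hyw⟩ := avoid w₁
  obtain ⟨w₂, hw, hw₂⟩ :=
    (h.2 {w₁} (by simp) v (by simpa using hvw) y (by simpa using hyw)).exists_first_edge hyv.symm
  exact ⟨w₁, w₂, fun heq => hw (by simp [heq]), hw₁, hw₂⟩

theorem TwoVertexConnected.two_mul_card_le {V : Type*} [Fintype V] {E : Finset (V × V)}
    (h : TwoVertexConnected V E) (hloop : ∀ u : V, (u, u) ∉ E) :
    2 * Fintype.card V ≤ E.card := by
  classical
  calc 2 * Fintype.card V = ∑ _v : V, 2 := by simp [mul_comm]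
    _ ≤ ∑ v : V, (E.filter fun e => e.1 = v).card := Finset.sum_le_sum fun v _ => by
        obtain ⟨w₁, w₂, hne, hw₁, hw₂⟩ := h.exists_two_outNeighbors hloop v
        exact Finset.one_lt_card.2 ⟨(v, w₁), by simpa using hw₁, (v, w₂), by simpa using hw₂,
          by simpa using hne⟩
    _ = E.card := (Finset.card_eq_sum_card_fiberwise fun _ _ => Finset.mem_coe.2
        (Finset.mem_univ _)).symm

/-- in a 2-vertex-twinless connected graph without self-loops on `n` vertices,
every 2-vertex-twinless connected spanning subgraph has at least `2n` edges. -/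
theorem stmt10 {V : Type*} [Fintype V] (E : Finset (V × V)) (n : ℕ)
    (hn : n = Fintype.card V)
    (hloop : ∀ u : V, (u, u) ∉ E)
    (hG : TwoVertexTwinlessConnected V E) :
    ∀ E2t ⊆ E, TwoVertexTwinlessConnected V E2t → 2 * n ≤ E2t.card := by
  intro E2t hE2t h
  rw [hn]
  exact h.twoVertexConnected.two_mul_card_le fun u hu => hloop u (hE2t hu)
end
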